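/- arXiv:2502.07770 — 2 statements merged into one kernel-verified Lean document; each statement's English description precedes it below -/
import Mathlib

section
/- Let n ≥ 1, σ > 0, 0 < ε₀ ≤ 1/4, and γ ∈ ℂⁿ. Define p_γ(α) = (2σ²/π)ⁿ · exp(−2σ²|α|²) · (1 + 4ε₀·sin(2·Im(α†γ))). Then for every β ∈ ℂⁿ, ∫_{ℂⁿ} p_γ(α)·exp(α†β − β†α) dα = exp(−|β|²/(2σ²)) + 2iε₀·exp(−|β−γ|²/(2σ²)) − 2iε₀·exp(−|β+γ|²/(2σ²)). -/
open MeasureTheory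

/-- `α† β = ∑ j conj(α j) * β j`. -/
noncomputable def dotc {n : ℕ} (α β : Fin n → ℂ) : ℂ :=
  ∑ j, (starRingEnd ℂ) (α j) * β j

/-- squared Euclidean norm `|α|² = ∑ j |α j|²` on ℂⁿ. -/
noncomputable def nsq {n : ℕ} (α : Fin n → ℂ) : ℝ :=
  ∑ j, Complex.normSq (α j)

/-- The density of the three-peak random displacement process. -/
noncomputable def threePeakDensity {n : ℕ} (σ ε₀ : ℝ) (γ : Fin n → ℂ)
    (α : Fin n → ℂ) : ℝ :=
  (2 * σ ^ 2 / Real.pi) ^ n * Real.exp (-2 * σ ^ 2 * nsq α) *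
    (1 + 4 * ε₀ * Real.sin (2 * (dotc α γ).im))

/-- The Fourier transform of a centred Gaussian on `ℂ`. -/
lemma integral_gaussian_displacement {b : ℝ} (hb : 0 < b) (w : ℂ) :
    ∫ z : ℂ, Complex.exp (-b * Complex.normSq z +
      ((starRingEnd ℂ) z * w - (starRingEnd ℂ) w * z)) =
      Real.pi / b * Complex.exp (-(Complex.normSq w) / b) := by
  have h := GaussianFourier.integral_cexp_neg_mul_sq_norm_add (V := ℂ) (b := (b : ℂ))
    (by simpa using hb) (2 * Complex.I) (-Complex.I * w)
  have hb' : (b : ℂ) ≠ 0 := by exact_mod_cast hb.ne'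
  convert h using 1
  · congr 1
    ext z
    congr 2
    · rw [Complex.normSq_eq_norm_sq]
      push_cast
      rfl
    · apply Complex.ext <;> simp [Complex.inner] <;> ring
  · rw [Complex.finrank_real_complex, Complex.normSq_eq_norm_sq]
    simp only [Nat.cast_ofNat, norm_mul, norm_neg, Complex.norm_I, one_mul,
      div_self (two_ne_zero' ℂ), Complex.cpow_one, mul_pow, Complex.I_sq]
    congr 2
    push_cast
    field

/-- The exponent splits into a sum over modes. -/
lemma neg_mul_nsq_add_dotc_sub {n : ℕ} (b : ℝ) (α β : Fin n → ℂ) :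
    -b * nsq α + (dotc α β - dotc β α) =
      ∑ j, (-b * Complex.normSq (α j) +
        ((starRingEnd ℂ) (α j) * β j - (starRingEnd ℂ) (β j) * α j)) := by
  simp [nsq, dotc, Finset.sum_add_distrib, Finset.mul_sum]

/-- The Fourier transform of a centred Gaussian on `ℂⁿ`. -/
lemma integral_gaussian_dotc {n : ℕ} {b : ℝ} (hb : 0 < b) (β : Fin n → ℂ) :
    ∫ α : Fin n → ℂ, Complex.exp (-b * nsq α + (dotc α β - dotc β α)) =
      (Real.pi / b) ^ n * Complex.exp (-(nsq β) / b) := by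
  simp_rw [neg_mul_nsq_add_dotc_sub, Complex.exp_sum]
  rw [integral_fintype_prod_volume_eq_prod (f := fun j (z : ℂ) ↦ Complex.exp
    (-b * Complex.normSq z + ((starRingEnd ℂ) z * β j - (starRingEnd ℂ) (β j) * z)))]
  simp_rw [integral_gaussian_displacement hb, Finset.prod_mul_distrib, ← Complex.exp_sum]
  simp [nsq, neg_div, Finset.sum_div, div_pow]

lemma integrable_gaussian_dotc {n : ℕ} {b : ℝ} (hb : 0 < b) (β : Fin n → ℂ) :
    Integrable fun α : Fin n → ℂ ↦ Complex.exp (-b * nsq α + (dotc α β - dotc β α)) := by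
  refine Integrable.of_integral_ne_zero ?_
  rw [integral_gaussian_dotc hb]
  have : (b : ℂ) ≠ 0 := by exact_mod_cast hb.ne'
  exact mul_ne_zero (pow_ne_zero _ (div_ne_zero (by exact_mod_cast Real.pi_ne_zero) this))
    (Complex.exp_ne_zero _)

lemma dotc_sub_dotc {n : ℕ} (α β : Fin n → ℂ) :
    dotc α β - dotc β α = 2 * (dotc α β).im * Complex.I := by
  have h : dotc β α = (starRingEnd ℂ) (dotc α β) := by
    simp [dotc, mul_comm]
  rw [h, Complex.sub_conj]
  push_cast
  ring

lemma dotc_add {n : ℕ} (α β γ : Fin n → ℂ) : dotc α (β + γ) = dotc α β + dotc α γ := by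
  simp [dotc, mul_add, Finset.sum_add_distrib]

lemma dotc_sub {n : ℕ} (α β γ : Fin n → ℂ) : dotc α (β - γ) = dotc α β - dotc α γ := by
  simp [dotc, mul_sub]

/-- The integrand of the characteristic function as a combination of three Gaussians. -/
lemma threePeakDensity_mul_exp {n : ℕ} (σ ε₀ : ℝ) (γ α β : Fin n → ℂ) :
    ((threePeakDensity σ ε₀ γ α : ℝ) : ℂ) * Complex.exp (dotc α β - dotc β α) =
      (2 * σ ^ 2 / Real.pi) ^ n *
        (Complex.exp (-(2 * σ ^ 2 : ℝ) * nsq α + (dotc α β - dotc β α))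
        + 2 * Complex.I * ε₀ * Complex.exp (-(2 * σ ^ 2 : ℝ) * nsq α
          + (dotc α (β - γ) - dotc (β - γ) α))
        - 2 * Complex.I * ε₀ * Complex.exp (-(2 * σ ^ 2 : ℝ) * nsq α
          + (dotc α (β + γ) - dotc (β + γ) α))) := by
  rw [dotc_sub_dotc α β, dotc_sub_dotc α (β - γ), dotc_sub_dotc α (β + γ), dotc_add, dotc_sub,
    threePeakDensity, Complex.add_im, Complex.sub_im]
  push_cast
  rw [Complex.sin]
  simp only [mul_add, mul_sub, add_mul, sub_mul, Complex.exp_add, Complex.exp_sub,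
    Complex.exp_neg, neg_mul]
  field_simp
  ring

/-- the displacement characteristic function of the three-peak
process `p_γ` equals
`exp(−|β|²/(2σ²)) + 2iε₀·exp(−|β−γ|²/(2σ²)) − 2iε₀·exp(−|β+γ|²/(2σ²))`. -/
theorem threePeak_characteristic_function (n : ℕ) (hn : 1 ≤ n)
    (σ ε₀ : ℝ) (hσ : 0 < σ) (hε₀ : 0 < ε₀) (hε₀' : ε₀ ≤ 1 / 4)
    (γ : Fin n → ℂ) (β : Fin n → ℂ) :
    (∫ α : Fin n → ℂ,
        ((threePeakDensity σ ε₀ γ α : ℝ) : ℂ) * Complex.exp (dotc α β - dotc β α))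
      = Complex.exp (((-(nsq β) / (2 * σ ^ 2) : ℝ) : ℂ))
        + 2 * Complex.I * (ε₀ : ℂ) * Complex.exp (((-(nsq (β - γ)) / (2 * σ ^ 2) : ℝ) : ℂ))
        - 2 * Complex.I * (ε₀ : ℂ) * Complex.exp (((-(nsq (β + γ)) / (2 * σ ^ 2) : ℝ) : ℂ)) := by
  have hb : 0 < 2 * σ ^ 2 := by positivity
  have hσ' : (σ : ℂ) ≠ 0 := by exact_mod_cast hσ.ne'
  have hπ : (Real.pi : ℂ) ≠ 0 := by exact_mod_cast Real.pi_ne_zero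
  have hi := integrable_gaussian_dotc (n := n) hb
  have hc : (2 * (σ : ℂ) ^ 2 / Real.pi) ^ n * (Real.pi / (2 * (σ : ℂ) ^ 2)) ^ n = 1 := by
    rw [← mul_pow, div_mul_div_cancel₀ hπ, div_self (by simpa using hσ'), one_pow]
  simp_rw [threePeakDensity_mul_exp]
  rw [integral_const_mul, integral_sub ((hi β).fun_add ((hi _).const_mul _)) ((hi _).const_mul _),
    integral_add (hi β) ((hi _).const_mul _), integral_const_mul, integral_const_mul]
  simp_rw [integral_gaussian_dotc hb]
  push_cast
  linear_combination (Complex.exp (-(nsq β) / (2 * σ ^ 2))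
    + 2 * Complex.I * ε₀ * Complex.exp (-(nsq (β - γ)) / (2 * σ ^ 2))
    - 2 * Complex.I * ε₀ * Complex.exp (-(nsq (β + γ)) / (2 * σ ^ 2))) * hc
end

section
/- (Separation of the two hypotheses at the peak.) Let n ≥ 1, σ > 0, ε₀ > 0, s ∈ {+1, −1}, and γ ∈ ℂⁿ. Define λ₀(β) = exp(−|β|²/(2σ²)) and λ_{γ,s}(β) = λ₀(β) + 2isε₀·(exp(−|β − sγ|²/(2σ²)) − exp(−|β + sγ|²/(2σ²))). Then |λ_{γ,s}(γ) − λ₀(γ)| = 2ε₀·(1 − exp(−2|γ|²/σ²)). In particular, if ε = 0.98·ε₀ and |γ|² > 2σ², then |λ_{γ,s}(γ) − λ₀(γ)| ≥ 2ε. -/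
open MeasureTheory

/-- Characteristic function of the Gaussian random displacement process. -/
noncomputable def lamZero {n : ℕ} (σ : ℝ) (β : Fin n → ℂ) : ℂ :=
  Complex.exp (((-(nsq β) / (2 * σ ^ 2) : ℝ) : ℂ))

/-- Characteristic function of the three-peak process with side peaks at `±sγ`. -/
noncomputable def lamThreePeak {n : ℕ} (σ ε₀ s : ℝ) (γ : Fin n → ℂ)
    (β : Fin n → ℂ) : ℂ :=
  lamZero σ β + 2 * Complex.I * (s : ℂ) * (ε₀ : ℂ) *
    (Complex.exp (((-(nsq (β - s • γ)) / (2 * σ ^ 2) : ℝ) : ℂ))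
      - Complex.exp (((-(nsq (β + s • γ)) / (2 * σ ^ 2) : ℝ) : ℂ)))

theorem nsq_nonneg {n : ℕ} (α : Fin n → ℂ) : 0 ≤ nsq α :=
  Finset.sum_nonneg fun _ _ => Complex.normSq_nonneg _

theorem nsq_add_self {n : ℕ} (α : Fin n → ℂ) : nsq (α + α) = 4 * nsq α := by
  simp only [nsq, Finset.mul_sum, Pi.add_apply]
  refine Finset.sum_congr rfl fun j _ => ?_
  simp only [Complex.normSq_apply, Complex.add_re, Complex.add_im]
  ring

theorem nsq_zero {n : ℕ} : nsq (0 : Fin n → ℂ) = 0 := by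
  simp [nsq]

theorem norm_two_mul_I_mul_exp_sub_exp {s ε₀ : ℝ} (hs : |s| = 1) (hε₀ : 0 ≤ ε₀) (a b : ℝ) :
    ‖2 * Complex.I * (s : ℂ) * (ε₀ : ℂ) * (Complex.exp (a : ℂ) - Complex.exp (b : ℂ))‖
      = 2 * ε₀ * |Real.exp a - Real.exp b| := by
  rw [← Complex.ofReal_exp, ← Complex.ofReal_exp, ← Complex.ofReal_sub]
  simp only [norm_mul, Complex.norm_real, Complex.norm_I, Complex.norm_ofNat, Real.norm_eq_abs,
    hs, abs_of_nonneg hε₀, mul_one]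

theorem norm_lamThreePeak_sub_lamZero {n : ℕ} {σ ε₀ s : ℝ} (hε₀ : 0 ≤ ε₀)
    (hs : s = 1 ∨ s = -1) (γ : Fin n → ℂ) :
    ‖lamThreePeak σ ε₀ s γ γ - lamZero σ γ‖
      = 2 * ε₀ * (1 - Real.exp (-2 * nsq γ / σ ^ 2)) := by
  have hexp : -(4 * nsq γ) / (2 * σ ^ 2) = -2 * nsq γ / σ ^ 2 := by
    rw [show -(4 * nsq γ) = 2 * (-2 * nsq γ) by ring, mul_div_mul_left _ _ two_ne_zero]
  have hle : Real.exp (-2 * nsq γ / σ ^ 2) ≤ 1 :=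
    Real.exp_le_one_iff.mpr
      (div_nonpos_of_nonpos_of_nonneg (by linarith [nsq_nonneg γ]) (sq_nonneg σ))
  rw [lamThreePeak, add_sub_cancel_left,
    norm_two_mul_I_mul_exp_sub_exp (by rcases hs with rfl | rfl <;> simp) hε₀]
  rcases hs with rfl | rfl
  · rw [one_smul, sub_self, nsq_add_self, nsq_zero, hexp, neg_zero, zero_div, Real.exp_zero,
      abs_of_nonneg (sub_nonneg.mpr hle)]
  · rw [neg_one_smul, sub_neg_eq_add, add_neg_cancel, nsq_add_self, nsq_zero, hexp, neg_zero,
      zero_div, Real.exp_zero, abs_sub_comm, abs_of_nonneg (sub_nonneg.mpr hle)]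

theorem exp_neg_four_le : Real.exp (-4) ≤ 0.02 := by
  have h : (50 : ℝ) ≤ Real.exp 4 := by
    rw [show (4 : ℝ) = (4 : ℕ) * 1 by norm_num, Real.exp_nat_mul]
    calc (50 : ℝ) ≤ 2.7 ^ 4 := by norm_num
      _ ≤ Real.exp 1 ^ 4 := by
        gcongr
        linarith [Real.exp_one_gt_d9]
  rw [Real.exp_neg]
  exact (inv_anti₀ (by norm_num) h).trans (by norm_num)

/-- separation of the two hypotheses at the peak:
`|λ_{γ,s}(γ) − λ₀(γ)| = 2ε₀(1 − exp(−2|γ|²/σ²))`, and if `ε = 0.98·ε₀` and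
`|γ|² > 2σ²` then `|λ_{γ,s}(γ) − λ₀(γ)| ≥ 2ε`. -/
theorem hypotheses_separation_at_peak (n : ℕ) (hn : 1 ≤ n) (σ ε₀ : ℝ)
    (hσ : 0 < σ) (hε₀ : 0 < ε₀) (s : ℝ) (hs : s = 1 ∨ s = -1) (γ : Fin n → ℂ) :
    ‖lamThreePeak σ ε₀ s γ γ - lamZero σ γ‖
        = 2 * ε₀ * (1 - Real.exp (-2 * nsq γ / σ ^ 2)) ∧
    (∀ ε : ℝ, ε = 0.98 * ε₀ → 2 * σ ^ 2 < nsq γ →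
      2 * ε ≤ ‖lamThreePeak σ ε₀ s γ γ - lamZero σ γ‖) := by
  have hnorm := norm_lamThreePeak_sub_lamZero (σ := σ) hε₀.le hs γ
  refine ⟨hnorm, ?_⟩
  rintro ε rfl hγ
  have hle : Real.exp (-2 * nsq γ / σ ^ 2) ≤ 0.02 := by
    refine (Real.exp_le_exp.mpr ?_).trans exp_neg_four_le
    rw [div_le_iff₀ (by positivity)]
    linarith
  rw [hnorm]
  nlinarith
end
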